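/- arXiv:1910.10955 — 2 statements merged into one kernel-verified Lean document; each statement's English description precedes it below -/
import Mathlib

section
/- For every λ ∈ ℂ, every k ∈ ℕ and every x ∈ ℝ, the k-th derivative of the function g_λ(x) = exp(λ x²/2) satisfies ∂^k g_λ(x) = p_{λ,k}(x) · exp(λ x²/2), where p_{λ,k}(x) = k! · Σ_{m=0}^{⌊k/2⌋} x^{k−2m} λ^{k−m} / (m! (k−2m)! 2^m). -/
open scoped Nat

noncomputable def gT (l : ℂ) (k m : ℕ) (x : ℝ) : ℂ :=
  if 2 * m ≤ k then
    (x : ℂ) ^ (k - 2 * m) * l ^ (k - m) / ((m ! : ℂ) * ((k - 2 * m)! : ℂ) * 2 ^ m) else 0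

noncomputable def gQ (l : ℂ) (k : ℕ) (x : ℝ) : ℂ :=
  ∑ m ∈ Finset.range (k / 2 + 1), gT l k m x

lemma gQ_eq (l : ℂ) (k N : ℕ) (x : ℝ) (h : k / 2 + 1 ≤ N) :
    gQ l k x = ∑ m ∈ Finset.range N, gT l k m x := by
  unfold gQ
  apply Finset.sum_subset
  · intro a; simp only [Finset.mem_range]; omega
  · intro a _ h2
    simp only [Finset.mem_range] at h2
    unfold gT
    rw [if_neg (by omega)]

lemma gT_deriv (l : ℂ) (k m : ℕ) (x : ℝ) :
    HasDerivAt (fun y => gT l (k + 1) m y) (l * gT l k m x) x := by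
  unfold gT
  by_cases h : 2 * m ≤ k
  · obtain ⟨j, rfl⟩ := Nat.exists_eq_add_of_le h
    have e1 : 2 * m + j + 1 - 2 * m = j + 1 := by omega
    have e2 : 2 * m + j - 2 * m = j := by omega
    have e3 : 2 * m + j + 1 - m = m + j + 1 := by omega
    have e4 : 2 * m + j - m = m + j := by omega
    simp only [if_pos h, if_pos (show 2 * m ≤ 2 * m + j + 1 by omega), e1, e2, e3, e4]
    have hd : HasDerivAt (fun y : ℝ => (y : ℂ) ^ (j + 1)) (((j + 1 : ℕ) : ℂ) * (x : ℂ) ^ j) x := by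
      simpa using (hasDerivAt_pow (j + 1) (x : ℂ)).comp_ofReal
    refine ((hd.mul_const (l ^ (m + j + 1))).div_const
      ((m ! : ℂ) * ((j + 1)! : ℂ) * 2 ^ m)).congr_deriv ?_
    have h1 : (m ! : ℂ) ≠ 0 := by exact_mod_cast m.factorial_ne_zero
    have h2 : (j ! : ℂ) ≠ 0 := by exact_mod_cast j.factorial_ne_zero
    have h3 : ((j : ℂ) + 1) ≠ 0 := by exact_mod_cast j.succ_ne_zero
    rw [Nat.factorial_succ]
    push_cast
    field_simp
    ring
  · rw [if_neg h, mul_zero]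
    by_cases h' : 2 * m ≤ k + 1
    · have e : k + 1 - 2 * m = 0 := by omega
      simp only [if_pos h', e, pow_zero]
      exact hasDerivAt_const _ _
    · simp only [if_neg h']
      exact hasDerivAt_const _ _

lemma gQ_deriv (l : ℂ) (k : ℕ) (x : ℝ) :
    HasDerivAt (fun y => gQ l (k + 1) y) (l * gQ l k x) x := by
  rw [gQ_eq l k ((k + 1) / 2 + 1) x (by omega), Finset.mul_sum]
  unfold gQ
  exact HasDerivAt.fun_sum fun m _ => gT_deriv l k m x

lemma gT_rec0 (l : ℂ) (k : ℕ) (x : ℝ) :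
    ((k : ℂ) + 1) * gT l (k + 1) 0 x = l * x * gT l k 0 x := by
  have h2 : (k ! : ℂ) ≠ 0 := by exact_mod_cast k.factorial_ne_zero
  have h3 : ((k : ℂ) + 1) ≠ 0 := by exact_mod_cast k.succ_ne_zero
  simp [gT, Nat.factorial_succ]
  field_simp
  ring

lemma gT_rec (l : ℂ) (k m : ℕ) (x : ℝ) :
    ((k : ℂ) + 2) * gT l (k + 2) (m + 1) x = l * x * gT l (k + 1) (m + 1) x + l * gT l k m x := by
  unfold gT
  by_cases h : 2 * m ≤ k
  · obtain ⟨j, rfl⟩ := Nat.exists_eq_add_of_le h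
    have h1 : (m ! : ℂ) ≠ 0 := by exact_mod_cast m.factorial_ne_zero
    have h4 : ((m : ℂ) + 1) ≠ 0 := by exact_mod_cast m.succ_ne_zero
    have e1 : 2 * m + j + 2 - 2 * (m + 1) = j := by omega
    have e2 : 2 * m + j - 2 * m = j := by omega
    have e3 : 2 * m + j + 2 - (m + 1) = m + j + 1 := by omega
    have e4 : 2 * m + j - m = m + j := by omega
    rw [if_pos h, if_pos (by omega), e1, e2, e3, e4]
    rcases j with _ | j
    · rw [if_neg (by omega), Nat.factorial_succ]
      push_cast
      field_simp
      simp
      try ring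
    · have e5 : 2 * m + (j + 1) + 1 - 2 * (m + 1) = j := by omega
      have e6 : 2 * m + (j + 1) + 1 - (m + 1) = m + j + 1 := by omega
      rw [if_pos (by omega), e5, e6, Nat.factorial_succ, Nat.factorial_succ]
      have h2 : (j ! : ℂ) ≠ 0 := by exact_mod_cast j.factorial_ne_zero
      have h3 : ((j : ℂ) + 1) ≠ 0 := by exact_mod_cast j.succ_ne_zero
      push_cast
      field_simp
      try ring
  · rw [if_neg h, if_neg (by omega), if_neg (by omega)]
    simp

lemma gQ_rec (l : ℂ) (k : ℕ) (x : ℝ) :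
    ((k : ℂ) + 2) * gQ l (k + 2) x = l * x * gQ l (k + 1) x + l * gQ l k x := by
  rw [gQ_eq l (k + 2) (k + 2 + 1) x (by omega), gQ_eq l (k + 1) (k + 2 + 1) x (by omega),
    gQ_eq l k (k + 2) x (by omega), Finset.sum_range_succ', Finset.sum_range_succ' _ (k + 2),
    mul_add, mul_add, Finset.mul_sum, Finset.mul_sum, Finset.mul_sum]
  simp only [gT_rec, Finset.sum_add_distrib]
  have := gT_rec0 l (k + 1) x
  push_cast at this
  linear_combination this

lemma g_deriv (l : ℂ) (x : ℝ) :
    HasDerivAt (fun y : ℝ => Complex.exp (l * (y : ℂ) ^ 2 / 2))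
      (l * x * Complex.exp (l * (x : ℂ) ^ 2 / 2)) x := by
  have hd : HasDerivAt (fun y : ℝ => (y : ℂ) ^ 2) (2 * (x : ℂ)) x := by
    simpa using (hasDerivAt_pow 2 (x : ℂ)).comp_ofReal
  refine ((hd.const_mul l).div_const 2).cexp.congr_deriv ?_
  ring

lemma g_main (l : ℂ) (k : ℕ) :
    iteratedDeriv k (fun y : ℝ => Complex.exp (l * (y : ℂ) ^ 2 / 2)) =
      fun x => ((k ! : ℂ) * gQ l k x) * Complex.exp (l * (x : ℂ) ^ 2 / 2) := by
  induction k with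
  | zero => ext x; simp [gQ, gT]
  | succ k ih =>
    rw [iteratedDeriv_succ, ih]
    ext x
    rcases k with _ | k
    · simp [gQ, gT, (g_deriv l x).deriv]
      try ring
    · rw [(((gQ_deriv l k x).const_mul _).fun_mul (g_deriv l x)).deriv, Nat.factorial_succ (k + 1)]
      have := gQ_rec l k x
      push_cast
      linear_combination (-((k + 1)! : ℂ) * Complex.exp (l * (x : ℂ) ^ 2 / 2)) * this

/-- For every `λ ∈ ℂ`, `k ∈ ℕ` and `x ∈ ℝ`, the `k`-th derivative of
`g_λ(x) = exp(λ x²/2)` equals `p_{λ,k}(x) · exp(λ x²/2)` with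
`p_{λ,k}(x) = k! · ∑_{m=0}^{⌊k/2⌋} x^{k−2m} λ^{k−m} / (m! (k−2m)! 2^m)`. -/
theorem gaussian_iteratedDeriv (l : ℂ) (k : ℕ) (x : ℝ) :
    iteratedDeriv k (fun y : ℝ => Complex.exp (l * (y : ℂ) ^ 2 / 2)) x =
      ((k ! : ℂ) *
        ∑ m ∈ Finset.range (k / 2 + 1),
          (x : ℂ) ^ (k - 2 * m) * l ^ (k - m) / ((m ! : ℂ) * ((k - 2 * m)! : ℂ) * 2 ^ m)) *
      Complex.exp (l * (x : ℂ) ^ 2 / 2) := by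
  rw [g_main]
  suffices this : gQ l k x = ∑ m ∈ Finset.range (k / 2 + 1),
      (x : ℂ) ^ (k - 2 * m) * l ^ (k - m) / ((m ! : ℂ) * ((k - 2 * m)! : ℂ) * 2 ^ m) by
    beta_reduce
    rw [this]
  unfold gQ
  apply Finset.sum_congr rfl
  intro m hm
  rw [Finset.mem_range] at hm
  unfold gT
  rw [if_pos (by omega)]
end

section
/- For every δ > 0, every h > 0, every d ≥ 1, and every multi-index κ ∈ ℕ^d, one has (κ!)^{−δ} · h^{−2|κ|} ≤ exp(δ d h^{−2/δ}). -/
open scoped Nat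

/-- For every `δ > 0`, `h > 0`, `d ≥ 1` and every multi-index `κ ∈ ℕ^d`:
`(κ!)^{−δ} · h^{−2|κ|} ≤ exp(δ d h^{−2/δ})`. -/
theorem factorial_rpow_inv_mul_pow_le (δ h : ℝ) (hδ : 0 < δ) (hh : 0 < h)
    (d : ℕ) (hd : 1 ≤ d) (κ : Fin d → ℕ) :
    ((∏ j, ((κ j)! : ℝ)) ^ (-δ)) * h ^ (-(2 * (∑ j, κ j : ℝ))) ≤
      Real.exp (δ * d * h ^ (-(2 / δ))) := by
  have hx : 0 < h ^ (-(2 / δ)) := Real.rpow_pos_of_pos hh _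
  have hP : 0 < ∏ j, ((κ j)! : ℝ) := Finset.prod_pos fun j _ => by positivity
  have key : (h ^ (-(2 / δ))) ^ (∑ j, κ j) / (∏ j, ((κ j)! : ℝ)) ≤
      Real.exp (d * h ^ (-(2 / δ))) := by
    rw [← Finset.prod_pow_eq_pow_sum, ← Finset.prod_div_distrib, Real.exp_nat_mul]
    calc _ ≤ ∏ _j : Fin d, Real.exp (h ^ (-(2 / δ))) :=
          Finset.prod_le_prod (fun j _ => by positivity)
            (fun j _ => Real.pow_div_factorial_le_exp _ hx.le _)
      _ = _ := by simp
  have h2 := Real.rpow_le_rpow (by positivity) key hδ.le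
  rw [Real.div_rpow (by positivity) hP.le, ← Real.exp_mul, ← Real.rpow_natCast,
    ← Real.rpow_mul hh.le, ← Real.rpow_mul hh.le, div_eq_mul_inv, ← Real.rpow_neg hP.le] at h2
  have e1 : -(2 / δ) * ((∑ j, κ j : ℕ) : ℝ) * δ = -(2 * (∑ j, κ j : ℝ)) := by
    push_cast
    field_simp
  rw [e1] at h2
  rw [mul_comm]
  refine h2.trans (le_of_eq ?_)
  congr 1
  ring
end
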